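/- Fix p with p=0 or p∈(−∞,0)∪(0,1), b ∈ ℝ^d, c a symmetric positive semidefinite d×d matrix, and a Lévy measure F on ℝ^d satisfying ∫ |z|²∧log(1+|z|) F(dz) < ∞ if p=0 and ∫ |z|²∧|z|^{p(1+ε)} F(dz) < ∞ for some ε>0 if p∈(0,1) (no extra condition if p<0). Then the set C^0_F := {y ∈ ℝ^d : F({z : y^⊤z < −1}) = 0} is convex, and the function g^{(b,c,F)} is concave on C^0_F in the extended sense: for all y₀, y₁ ∈ C^0_F and t ∈ [0,1], g^{(b,c,F)}(t·y₀+(1−t)·y₁) ≥ t·g^{(b,c,F)}(y₀) + (1−t)·g^{(b,c,F)}(y₁) in [−∞,∞). -/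

import Mathlib

open MeasureTheory Filter Set
open scoped ENNReal NNReal Topology

noncomputable section

/-- The positive part of an extended real number, as an element of `ℝ≥0∞`. -/
def EReal.posPart (x : EReal) : ℝ≥0∞ := if x = ⊤ then ⊤ else ENNReal.ofReal x.toReal

/-- Integral of an `EReal`-valued function, defined as the difference of the lintegrals of
the positive and negative parts, with the conventions of `EReal` arithmetic
(in particular `∞ - ∞ = -∞`). -/
def eIntegral {α : Type*} [MeasurableSpace α] (F : Measure α) (f : α → EReal) : EReal :=
  ((∫⁻ z, (f z).posPart ∂F : ℝ≥0∞) : EReal) - ((∫⁻ z, (-(f z)).posPart ∂F : ℝ≥0∞) : EReal)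

/-- The dot product `y^⊤ z` on `ℝ^d`. -/
def dotp {d : ℕ} (y z : EuclideanSpace ℝ (Fin d)) : ℝ := ∑ i, y i * z i

/-- The quadratic form `y^⊤ c y`. -/
def quadf {d : ℕ} (c : Matrix (Fin d) (Fin d) ℝ) (y : EuclideanSpace ℝ (Fin d)) : ℝ :=
  ∑ i, ∑ j, c i j * y i * y j

/-- The (Frobenius) norm `|c|` of a matrix. -/
def matNorm {d : ℕ} (c : Matrix (Fin d) (Fin d) ℝ) : ℝ :=
  Real.sqrt (∑ i, ∑ j, (c i j) ^ 2)

/-- A Lévy measure on `ℝ^d`: a (Borel) measure with `F({0}) = 0` and `∫ |z|² ∧ 1 F(dz) < ∞`. -/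
def IsLevyMeasure {d : ℕ} (F : Measure (EuclideanSpace ℝ (Fin d))) : Prop :=
  F {0} = 0 ∧ ∫⁻ z, ENNReal.ofReal (min (‖z‖ ^ 2) 1) ∂F < ⊤

/-- A truncation function: bounded, measurable, equal to the identity near the origin. -/
structure IsTruncation {d : ℕ}
    (h : EuclideanSpace ℝ (Fin d) → EuclideanSpace ℝ (Fin d)) : Prop where
  measurable : Measurable h
  bounded : ∃ M : ℝ, ∀ z, ‖h z‖ ≤ M
  eq_id_near_zero : ∃ δ : ℝ, 0 < δ ∧ ∀ z, ‖z‖ < δ → h z = z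

/-- The integrand `I_y(z)`, as an extended real number:
`log(1+y^⊤z) - y^⊤h(z)` if `p = 0`, and `p⁻¹(1+y^⊤z)^p - p⁻¹ - y^⊤h(z)` if `p ≠ 0`,
with the conventions `log 0 = -∞` and `0^p = +∞` for `p < 0` (so that the integrand
is `-∞` on `{1 + y^⊤z ≤ 0}` when `p ≤ 0`). -/
def Ifun {d : ℕ} (p : ℝ) (h : EuclideanSpace ℝ (Fin d) → EuclideanSpace ℝ (Fin d))
    (y z : EuclideanSpace ℝ (Fin d)) : EReal :=
  if 0 < 1 + dotp y z then
    (if p = 0 then ((Real.log (1 + dotp y z) - dotp y (h z) : ℝ) : EReal)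
      else ((p⁻¹ * (1 + dotp y z) ^ p - p⁻¹ - dotp y (h z) : ℝ) : EReal))
  else if p ≤ 0 then (⊥ : EReal)
  else ((p⁻¹ * (1 + dotp y z) ^ p - p⁻¹ - dotp y (h z) : ℝ) : EReal)

/-- The function `g^{(b,c,F)}(y) = y^⊤b + ((p-1)/2)·y^⊤cy + ∫ I_y(z) F(dz)`. -/
def gfun {d : ℕ} (p : ℝ) (h : EuclideanSpace ℝ (Fin d) → EuclideanSpace ℝ (Fin d))
    (b : EuclideanSpace ℝ (Fin d)) (c : Matrix (Fin d) (Fin d) ℝ)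
    (F : Measure (EuclideanSpace ℝ (Fin d))) (y : EuclideanSpace ℝ (Fin d)) : EReal :=
  ((dotp y b + (p - 1) / 2 * quadf c y : ℝ) : EReal) + eIntegral F (fun z => Ifun p h y z)

/-- Triples `θ = (b, c, F)`. -/
abbrev Triple (d : ℕ) :=
  EuclideanSpace ℝ (Fin d) × Matrix (Fin d) (Fin d) ℝ × Measure (EuclideanSpace ℝ (Fin d))

/-- `g^θ(y)` for a triple `θ = (b,c,F)`. -/
def gTheta {d : ℕ} (p : ℝ) (h : EuclideanSpace ℝ (Fin d) → EuclideanSpace ℝ (Fin d))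
    (θ : Triple d) (y : EuclideanSpace ℝ (Fin d)) : EReal :=
  gfun p h θ.1 θ.2.1 θ.2.2 y

/-- The integrand appearing in the definition of the constant `K`, depending on `p`
(and an extra parameter `ε > 0` when `p ∈ (0,1)`). -/
def Kintegrand {d : ℕ} (p ε : ℝ) (z : EuclideanSpace ℝ (Fin d)) : ℝ :=
  if p = 0 then min (‖z‖ ^ 2) (Real.log (1 + ‖z‖))
  else if 0 < p then min (‖z‖ ^ 2) (‖z‖ ^ (p * (1 + ε)))
  else min (‖z‖ ^ 2) 1

/-- The natural constraints `C⁰ = ∩_{F ∈ L_Θ} {y : F({z : y^⊤z < -1}) = 0}`. -/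
def natC {d : ℕ} (Θ : Set (Triple d)) : Set (EuclideanSpace ℝ (Fin d)) :=
  {y | ∀ θ ∈ Θ, θ.2.2 {z | dotp y z < -1} = 0}

/-- The sets `C⁰ₙ = ∩_{F ∈ L_Θ} {y : F({z : y^⊤z < -1 + 1/n}) = 0}`. -/
def natCn {d : ℕ} (Θ : Set (Triple d)) (n : ℕ) : Set (EuclideanSpace ℝ (Fin d)) :=
  {y | ∀ θ ∈ Θ, θ.2.2 {z | dotp y z < -1 + 1 / (n : ℝ)} = 0}

/-- The finite measure `|z|² ∧ 1 · F`. -/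
def sq1Measure {d : ℕ} (F : Measure (EuclideanSpace ℝ (Fin d))) :
    Measure (EuclideanSpace ℝ (Fin d)) :=
  F.withDensity (fun z => ENNReal.ofReal (min (‖z‖ ^ 2) 1))

/-- The standing assumptions of the paper: `p = 0` or `p ∈ (-∞,0) ∪ (0,1)`, `ε > 0`,
`h` is a truncation function, `Θ` is a nonempty convex set of Lévy triplets with `K < ∞`,
`C` is closed, convex and contains `0`, and `C ∩ C⁰` is compact. -/
structure Standing {d : ℕ} (p ε : ℝ)
    (h : EuclideanSpace ℝ (Fin d) → EuclideanSpace ℝ (Fin d))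
    (Θ : Set (Triple d)) (C : Set (EuclideanSpace ℝ (Fin d))) : Prop where
  p_range : p = 0 ∨ p < 0 ∨ (0 < p ∧ p < 1)
  eps_pos : 0 < ε
  trunc : IsTruncation h
  Theta_nonempty : Θ.Nonempty
  Theta_psd : ∀ θ ∈ Θ, (θ.2.1).PosSemidef
  Theta_levy : ∀ θ ∈ Θ, IsLevyMeasure θ.2.2
  Theta_convex : ∀ θ₁ ∈ Θ, ∀ θ₂ ∈ Θ, ∀ t : ℝ, 0 ≤ t → t ≤ 1 →
    (t • θ₁.1 + (1 - t) • θ₂.1, t • θ₁.2.1 + (1 - t) • θ₂.2.1,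
      ENNReal.ofReal t • θ₁.2.2 + ENNReal.ofReal (1 - t) • θ₂.2.2) ∈ Θ
  K_finite : ∃ K : ℝ, ∀ θ ∈ Θ,
    (∫⁻ z, ENNReal.ofReal (Kintegrand p ε z) ∂θ.2.2) ≠ ⊤ ∧
    ‖θ.1‖ + matNorm θ.2.1 + (∫⁻ z, ENNReal.ofReal (Kintegrand p ε z) ∂θ.2.2).toReal ≤ K
  C_closed : IsClosed C
  C_convex : Convex ℝ C
  C_zero : (0 : EuclideanSpace ℝ (Fin d)) ∈ C
  CC0_compact : IsCompact (C ∩ natC Θ)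

/-- The power utility `x ↦ p⁻¹ x ^ p - p⁻¹`, or the logarithm if `p = 0`. -/
def utility (p x : ℝ) : ℝ := if p = 0 then Real.log x else p⁻¹ * x ^ p - p⁻¹

/-- The set on which `utility p` is finite. -/
def utilityDomain (p : ℝ) : Set ℝ := if p ≤ 0 then Ioi 0 else Ici 0

lemma convexOn_rpow_of_neg {p : ℝ} (hp : p < 0) : ConvexOn ℝ (Ioi 0) fun x : ℝ => x ^ p := by
  refine ⟨convex_Ioi 0, fun x hx y hy a b ha hb hab => ?_⟩
  have hpos := convex_Ioi (𝕜 := ℝ) (0 : ℝ) hx hy ha hb hab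
  have hlog := strictConcaveOn_log_Ioi.concaveOn.2 hx hy ha hb hab
  have hexp := convexOn_exp.2 (mem_univ (Real.log x * p)) (mem_univ (Real.log y * p)) ha hb hab
  simp only [mem_Ioi, smul_eq_mul] at hx hy hpos hlog hexp ⊢
  rw [Real.rpow_def_of_pos hx, Real.rpow_def_of_pos hy, Real.rpow_def_of_pos hpos]
  exact (Real.exp_le_exp.2 (by nlinarith)).trans hexp

lemma concaveOn_utility {p : ℝ} (hp : p < 1) : ConcaveOn ℝ (utilityDomain p) (utility p) := by
  rcases lt_trichotomy p 0 with h0 | rfl | h0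
  · have h := ((convexOn_rpow_of_neg h0).smul (neg_nonneg.2 (inv_nonpos.2 h0.le))).neg.add_const
      (-p⁻¹)
    simp only [utilityDomain, if_pos h0.le]
    refine h.congr fun x _ => ?_
    simp [utility, h0.ne, sub_eq_add_neg]
  · simp only [utilityDomain, le_refl, if_true]
    exact strictConcaveOn_log_Ioi.concaveOn.congr fun x _ => by simp [utility]
  · have h := ((Real.strictConcaveOn_rpow h0 hp).concaveOn.smul (inv_nonneg.2 h0.le)).add_const
      (-p⁻¹)
    simp only [utilityDomain, if_neg h0.not_ge]
    refine h.congr fun x _ => ?_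
    simp [utility, h0.ne', sub_eq_add_neg]

lemma nonneg_of_mem_utilityDomain {p x : ℝ} (hx : x ∈ utilityDomain p) : 0 ≤ x := by
  unfold utilityDomain at hx
  split_ifs at hx
  exacts [le_of_lt hx, hx]

lemma utility_one_add_le {p x : ℝ} (hp : p < 1) (hx : 1 + x ∈ utilityDomain p) :
    utility p (1 + x) ≤ x := by
  have hx0 := nonneg_of_mem_utilityDomain hx
  rcases lt_trichotomy p 0 with h0 | rfl | h0
  · have hpos : 0 < 1 + x := by simpa [utilityDomain, h0.le] using! hx
    have h1 := Real.add_one_le_exp (Real.log (1 + x) * p)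
    have h2 := Real.log_le_sub_one_of_pos hpos
    have h3 : 1 + p * x ≤ (1 + x) ^ p := by
      rw [Real.rpow_def_of_pos hpos]
      nlinarith
    have h4 := mul_le_mul_of_nonpos_left h3 (inv_nonpos.2 h0.le)
    have h5 : p⁻¹ * (1 + p * x) = p⁻¹ + x := by field_simp [h0.ne]
    simp only [utility, h0.ne, if_false]
    linarith
  · have hpos : 0 < 1 + x := by simpa [utilityDomain] using! hx
    have h2 := Real.log_le_sub_one_of_pos hpos
    simp only [utility, if_true]
    linarith
  · have h3 := rpow_one_add_le_one_add_mul_self (by linarith : -1 ≤ x) h0.le hp.le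
    have h4 := mul_le_mul_of_nonneg_left h3 (inv_nonneg.2 h0.le)
    have h5 : p⁻¹ * (1 + p * x) = p⁻¹ + x := by field_simp [h0.ne']
    simp only [utility, h0.ne', if_false]
    linarith

lemma measurable_utility (p : ℝ) : Measurable (utility p) := by
  unfold utility
  split_ifs
  · exact Real.measurable_log
  · fun_prop

section DotProduct

variable {d : ℕ}

lemma dotp_eq_inner (y z : EuclideanSpace ℝ (Fin d)) : dotp y z = inner ℝ y z := by
  simp [dotp, PiLp.inner_apply, mul_comm]

lemma dotp_combo (s t : ℝ) (x y z : EuclideanSpace ℝ (Fin d)) :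
    dotp (s • x + t • y) z = s * dotp x z + t * dotp y z := by
  simp [dotp_eq_inner, inner_add_left, inner_smul_left]

lemma abs_dotp_le (y z : EuclideanSpace ℝ (Fin d)) : |dotp y z| ≤ ‖y‖ * ‖z‖ := by
  rw [dotp_eq_inner]
  exact abs_real_inner_le_norm y z

lemma measurable_dotp (y : EuclideanSpace ℝ (Fin d)) : Measurable (dotp y) := by
  have : dotp y = fun z => inner ℝ y z := funext (dotp_eq_inner y)
  rw [this]
  fun_prop

lemma quadf_nonneg {c : Matrix (Fin d) (Fin d) ℝ} (hc : c.PosSemidef)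
    (y : EuclideanSpace ℝ (Fin d)) : 0 ≤ quadf c y := by
  have key : quadf c y = star y.ofLp ⬝ᵥ c.mulVec y.ofLp := by
    simp only [quadf, dotProduct, Matrix.mulVec, Finset.mul_sum]
    refine Finset.sum_congr rfl fun i _ => Finset.sum_congr rfl fun j _ => ?_
    rw [Pi.star_apply, star_trivial]
    ring
  exact key ▸ hc.dotProduct_mulVec_nonneg y.ofLp

lemma quadf_combo_le {c : Matrix (Fin d) (Fin d) ℝ} (hc : c.PosSemidef)
    (x y : EuclideanSpace ℝ (Fin d)) {t : ℝ} (ht0 : 0 ≤ t) (ht1 : t ≤ 1) :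
    quadf c (t • x + (1 - t) • y) ≤ t * quadf c x + (1 - t) * quadf c y := by
  have key : quadf c (t • x + (1 - t) • y) + t * (1 - t) * quadf c (x - y)
      = t * quadf c x + (1 - t) * quadf c y := by
    simp only [quadf, Finset.mul_sum, ← Finset.sum_add_distrib]
    refine Finset.sum_congr rfl fun i _ => Finset.sum_congr rfl fun j _ => ?_
    simp
    ring
  have := mul_nonneg (mul_nonneg ht0 (sub_nonneg.2 ht1)) (quadf_nonneg hc (x - y))
  linarith

end DotProduct

section EIntegral

variable {α : Type*} [MeasurableSpace α] {F : Measure α} {f : α → EReal}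

lemma EReal.posPart_coe (x : ℝ) : EReal.posPart x = ENNReal.ofReal x := by
  simp [EReal.posPart]

lemma EReal.posPart_bot : EReal.posPart ⊥ = 0 := by simp [EReal.posPart]

lemma EReal.measurable_posPart : Measurable EReal.posPart :=
  Measurable.ite (measurableSet_singleton ⊤) measurable_const
    (ENNReal.measurable_ofReal.comp measurable_ereal_toReal)

lemma eIntegral_eq_bot (h : ∫⁻ z, (-(f z)).posPart ∂F = ⊤) : eIntegral F f = ⊥ := by
  simp [eIntegral, h]

lemma ae_ne_bot_of_lintegral_posPart_neg_ne_top (hf : Measurable f)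
    (h : ∫⁻ z, (-(f z)).posPart ∂F ≠ ⊤) : ∀ᵐ z ∂F, f z ≠ ⊥ := by
  filter_upwards [ae_lt_top (EReal.measurable_posPart.comp hf.neg) h] with z hz hbot
  simp [hbot, EReal.posPart] at hz

lemma eIntegral_congr_ae {g : α → EReal} (hfg : f =ᵐ[F] g) : eIntegral F f = eIntegral F g := by
  unfold eIntegral
  congr 2
  · exact lintegral_congr_ae (hfg.mono fun z hz => by simp only [hz])
  · exact lintegral_congr_ae (hfg.mono fun z hz => by simp only [hz])

lemma integrable_of_lintegral_ofReal_ne_top {u : α → ℝ} (hu : AEStronglyMeasurable u F)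
    (hpos : ∫⁻ z, ENNReal.ofReal (u z) ∂F ≠ ⊤) (hneg : ∫⁻ z, ENNReal.ofReal (-u z) ∂F ≠ ⊤) :
    Integrable u F := by
  refine ⟨hu, ?_⟩
  refine lt_of_le_of_lt (lintegral_mono fun z => ?_)
    (lt_of_eq_of_lt (lintegral_add_left' hu.aemeasurable.ennreal_ofReal _)
      (ENNReal.add_lt_top.2 ⟨hpos.lt_top, hneg.lt_top⟩))
  rw [← ofReal_norm, Real.norm_eq_abs]
  rcases abs_cases (u z) with h | h <;> rw [h.1] <;> simp

lemma eIntegral_coe {u : α → ℝ} (hu : Integrable u F) :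
    eIntegral F (fun z => (u z : EReal)) = ((∫ z, u z ∂F : ℝ) : EReal) := by
  simp only [eIntegral, ← EReal.coe_neg, EReal.posPart_coe]
  rw [integral_eq_lintegral_pos_part_sub_lintegral_neg_part hu, EReal.coe_sub,
    EReal.coe_ennreal_toReal hu.lintegral_lt_top.ne,
    EReal.coe_ennreal_toReal (x := ∫⁻ z, ENNReal.ofReal (-u z) ∂F) hu.neg.lintegral_lt_top.ne]

end EIntegral

section Integrand

variable {d : ℕ} {p : ℝ} {h : EuclideanSpace ℝ (Fin d) → EuclideanSpace ℝ (Fin d)}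
  {y z : EuclideanSpace ℝ (Fin d)}

lemma Ifun_of_mem (hz : 1 + dotp y z ∈ utilityDomain p) :
    Ifun p h y z = ((utility p (1 + dotp y z) - dotp y (h z) : ℝ) : EReal) := by
  unfold Ifun utility
  unfold utilityDomain at hz
  split_ifs at hz ⊢ <;> first | rfl | contradiction | exact absurd (Eq.le ‹p = 0›) ‹_›

lemma mem_utilityDomain_of_ne_bot (h0 : -1 ≤ dotp y z) (hz : Ifun p h y z ≠ ⊥) :
    1 + dotp y z ∈ utilityDomain p := by
  unfold utilityDomain
  unfold Ifun at hz
  split_ifs at hz ⊢ with h1 h2 h3 <;> simp_all <;> linarith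

lemma measurable_Ifun (p : ℝ) (hh : Measurable h) (y : EuclideanSpace ℝ (Fin d)) :
    Measurable (Ifun p h y) := by
  have hd := measurable_dotp y
  have hdh := (measurable_dotp y).comp hh
  have hset : MeasurableSet {z | 0 < 1 + dotp y z} :=
    measurableSet_lt measurable_const (hd.const_add 1)
  unfold Ifun
  refine Measurable.ite hset ?_ ?_
  · split_ifs
    · exact (((hd.const_add 1).log).sub hdh).coe_real_ereal
    · exact (((((hd.const_add 1).pow_const p).const_mul _).sub_const _).sub hdh).coe_real_ereal
  · split_ifs
    · exact measurable_const
    · exact (((((hd.const_add 1).pow_const p).const_mul _).sub_const _).sub hdh).coe_real_ereal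

end Integrand

lemma one_add_rpow_le {p r : ℝ} (hp0 : 0 < p) (hp1 : p < 1) (hr : 0 ≤ r) :
    (1 + r) ^ p ≤ 1 + r ^ p := by
  have := NNReal.rpow_add_le_add_rpow 1 ⟨r, hr⟩ hp0.le hp1.le
  rw [NNReal.one_rpow] at this
  exact_mod_cast this

lemma rpow_le_one_add_min {p ε r : ℝ} (hp0 : 0 < p) (hp1 : p < 1) (hε : 0 < ε) (hr : 0 ≤ r) :
    r ^ p ≤ 1 + min (r ^ 2) (r ^ (p * (1 + ε))) := by
  rcases le_total r 1 with h | h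
  · have := Real.rpow_le_one hr h hp0.le
    have : 0 ≤ min (r ^ 2) (r ^ (p * (1 + ε))) := by positivity
    linarith
  · have h1 : r ^ p ≤ r ^ 2 := by
      rw [← Real.rpow_two]
      exact Real.rpow_le_rpow_of_exponent_le h (by linarith)
    have h2 : r ^ p ≤ r ^ (p * (1 + ε)) :=
      Real.rpow_le_rpow_of_exponent_le h (by nlinarith)
    have := le_min h1 h2
    linarith

lemma log_one_add_le_one_add_min {r : ℝ} (hr : 0 ≤ r) :
    Real.log (1 + r) ≤ 1 + min (r ^ 2) (Real.log (1 + r)) := by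
  have h0 := Real.log_nonneg (by linarith : 1 ≤ 1 + r)
  have h3 := Real.log_le_sub_one_of_pos (by linarith : 0 < 1 + r)
  rcases le_total r 1 with h | h
  · have : 0 ≤ min (r ^ 2) (Real.log (1 + r)) := le_min (by positivity) h0
    linarith
  · have := le_min (by nlinarith : Real.log (1 + r) ≤ r ^ 2) le_rfl
    linarith

/-- The utility of `1 + y^⊤z` is dominated by an affine function of an integrable function. -/
lemma exists_utility_dominating {d : ℕ} {p : ℝ} (hp : p = 0 ∨ p < 0 ∨ (0 < p ∧ p < 1))
    {F : Measure (EuclideanSpace ℝ (Fin d))}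
    (hFint0 : p = 0 → ∫⁻ z, ENNReal.ofReal (min (‖z‖ ^ 2) (Real.log (1 + ‖z‖))) ∂F < ⊤)
    (hFintp : 0 < p → p < 1 →
      ∃ ε : ℝ, 0 < ε ∧ ∫⁻ z, ENNReal.ofReal (min (‖z‖ ^ 2) (‖z‖ ^ (p * (1 + ε)))) ∂F < ⊤) :
    ∃ K : EuclideanSpace ℝ (Fin d) → ℝ, (∀ z, 0 ≤ K z) ∧ ∫⁻ z, ENNReal.ofReal (K z) ∂F ≠ ⊤ ∧
      ∀ y, ∃ A B : ℝ, 0 ≤ A ∧ 0 ≤ B ∧ ∀ z, 1 + dotp y z ∈ utilityDomain p →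
        utility p (1 + dotp y z) ≤ A + B * K z := by
  have hlin : ∀ y z : EuclideanSpace ℝ (Fin d),
      1 + dotp y z ≤ (1 + ‖y‖) * (1 + ‖z‖) := fun y z => by
    have := (le_abs_self _).trans (abs_dotp_le y z)
    nlinarith [norm_nonneg y, norm_nonneg z]
  rcases hp with rfl | h0 | ⟨h0, h1⟩
  · refine ⟨fun z => min (‖z‖ ^ 2) (Real.log (1 + ‖z‖)), fun z => le_min (by positivity)
      (Real.log_nonneg (by linarith [norm_nonneg z])), (hFint0 rfl).ne, fun y => ?_⟩
    have hy : 0 ≤ Real.log (1 + ‖y‖) := Real.log_nonneg (by linarith [norm_nonneg y])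
    refine ⟨Real.log (1 + ‖y‖) + 1, 1, by linarith, zero_le_one, fun z hz => ?_⟩
    have hpos : 0 < 1 + dotp y z := by simpa [utilityDomain] using! hz
    have h2 := Real.log_le_log hpos (hlin y z)
    rw [Real.log_mul (by positivity) (by positivity)] at h2
    have h3 := log_one_add_le_one_add_min (norm_nonneg z)
    simp only [utility, if_true]
    linarith
  · refine ⟨fun _ => 0, fun _ => le_rfl, by simp, fun y => ⟨-p⁻¹, 0,
      neg_nonneg.2 (inv_nonpos.2 h0.le), le_rfl, fun z hz => ?_⟩⟩
    have := mul_nonpos_of_nonpos_of_nonneg (inv_nonpos.2 h0.le)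
      (Real.rpow_nonneg (nonneg_of_mem_utilityDomain hz) p)
    simp only [utility, h0.ne, if_false]
    linarith
  · obtain ⟨ε, hε, hK⟩ := hFintp h0 h1
    refine ⟨fun z => min (‖z‖ ^ 2) (‖z‖ ^ (p * (1 + ε))), fun z => by positivity, hK.ne,
      fun y => ⟨2 * (p⁻¹ * (1 + ‖y‖) ^ p), p⁻¹ * (1 + ‖y‖) ^ p, by positivity, by positivity,
        fun z hz => ?_⟩⟩
    have h2 := Real.rpow_le_rpow (nonneg_of_mem_utilityDomain hz) (hlin y z) h0.le
    rw [Real.mul_rpow (by positivity) (by positivity)] at h2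
    have h3 := one_add_rpow_le h0 h1 (norm_nonneg z)
    have h4 := rpow_le_one_add_min h0 h1 hε (norm_nonneg z)
    have h5 : p⁻¹ * (1 + dotp y z) ^ p ≤ p⁻¹ * ((1 + ‖y‖) ^ p * (1 + ‖z‖) ^ p) :=
      mul_le_mul_of_nonneg_left h2 (inv_nonneg.2 h0.le)
    have h6 := mul_le_mul_of_nonneg_left (h3.trans (add_le_add_right h4 1))
      (by positivity : 0 ≤ p⁻¹ * (1 + ‖y‖) ^ p)
    have h7 := inv_nonneg.2 h0.le
    simp only [utility, h0.ne', if_false]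
    linarith

lemma measure_norm_ge_ne_top {d : ℕ} {F : Measure (EuclideanSpace ℝ (Fin d))}
    (hF : IsLevyMeasure F) {δ : ℝ} (hδ : 0 < δ) : F {z | δ ≤ ‖z‖} ≠ ⊤ := by
  have hm : Measurable fun z : EuclideanSpace ℝ (Fin d) => ENNReal.ofReal (min (‖z‖ ^ 2) 1) := by
    fun_prop
  have h0 : ENNReal.ofReal (min (δ ^ 2) 1) ≠ 0 := by
    rw [Ne, ENNReal.ofReal_eq_zero, not_le]
    positivity
  refine ne_top_of_le_ne_top ?_ ((measure_mono fun z hz => ?_).trans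
    (meas_ge_le_lintegral_div hm.aemeasurable h0 ENNReal.ofReal_ne_top))
  · exact ENNReal.div_ne_top hF.2.ne h0
  · exact ENNReal.ofReal_le_ofReal (min_le_min_right 1 (pow_le_pow_left₀ hδ.le hz 2))

lemma lintegral_posPart_Ifun_ne_top {d : ℕ} {p : ℝ} (hp : p = 0 ∨ p < 0 ∨ (0 < p ∧ p < 1))
    {h : EuclideanSpace ℝ (Fin d) → EuclideanSpace ℝ (Fin d)} (hh : IsTruncation h)
    {F : Measure (EuclideanSpace ℝ (Fin d))} (hF : IsLevyMeasure F)
    (hFint0 : p = 0 → ∫⁻ z, ENNReal.ofReal (min (‖z‖ ^ 2) (Real.log (1 + ‖z‖))) ∂F < ⊤)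
    (hFintp : 0 < p → p < 1 →
      ∃ ε : ℝ, 0 < ε ∧ ∫⁻ z, ENNReal.ofReal (min (‖z‖ ^ 2) (‖z‖ ^ (p * (1 + ε)))) ∂F < ⊤)
    {y : EuclideanSpace ℝ (Fin d)} (hy : ∀ᵐ z ∂F, -1 ≤ dotp y z) :
    ∫⁻ z, (Ifun p h y z).posPart ∂F ≠ ⊤ := by
  have hp1 : p < 1 := by rcases hp with h | h | h <;> linarith
  obtain ⟨K, hK0, hK, hdom⟩ := exists_utility_dominating hp hFint0 hFintp
  obtain ⟨A, B, hA, hB, hAB⟩ := hdom y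
  obtain ⟨M, hM⟩ := hh.bounded
  obtain ⟨δ, hδ, hid⟩ := hh.eq_id_near_zero
  have hset : MeasurableSet {z : EuclideanSpace ℝ (Fin d) | δ ≤ ‖z‖} :=
    measurableSet_le measurable_const measurable_norm
  refine ne_top_of_le_ne_top (b := ∫⁻ z, ({z : EuclideanSpace ℝ (Fin d) | δ ≤ ‖z‖}.indicator
    (fun _ => ENNReal.ofReal (A + ‖y‖ * M)) z + ENNReal.ofReal B * ENNReal.ofReal (K z)) ∂F) ?_
    (lintegral_mono_ae ?_)
  · rw [lintegral_add_left (measurable_const.indicator hset), lintegral_indicator_const hset,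
      lintegral_const_mul' _ _ ENNReal.ofReal_ne_top]
    exact ENNReal.add_ne_top.2 ⟨ENNReal.mul_ne_top ENNReal.ofReal_ne_top
      (measure_norm_ge_ne_top hF hδ), ENNReal.mul_ne_top ENNReal.ofReal_ne_top hK⟩
  · filter_upwards [hy] with z hz
    by_cases hbot : Ifun p h y z = ⊥
    · simp [hbot, EReal.posPart_bot]
    have hmem := mem_utilityDomain_of_ne_bot hz hbot
    rw [Ifun_of_mem hmem, EReal.posPart_coe]
    by_cases hzδ : δ ≤ ‖z‖
    · rw [indicator_of_mem (by exact hzδ), ← ENNReal.ofReal_mul hB, ← ENNReal.ofReal_add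
        (add_nonneg hA (mul_nonneg (norm_nonneg _) ((norm_nonneg _).trans (hM 0))))
        (mul_nonneg hB (hK0 z))]
      have h1 := (neg_le_abs _).trans (abs_dotp_le y (h z))
      have h2 := mul_le_mul_of_nonneg_left (hM z) (norm_nonneg y)
      have h3 := hAB z hmem
      exact ENNReal.ofReal_le_ofReal (by linarith)
    · have h1 := utility_one_add_le hp1 hmem
      rw [hid z (not_le.1 hzδ), ENNReal.ofReal_of_nonpos (by linarith)]
      exact zero_le

lemma eIntegral_Ifun_eq_integral {d : ℕ} {p : ℝ}
    {h : EuclideanSpace ℝ (Fin d) → EuclideanSpace ℝ (Fin d)} (hh : Measurable h)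
    {F : Measure (EuclideanSpace ℝ (Fin d))} {y : EuclideanSpace ℝ (Fin d)}
    (hmem : ∀ᵐ z ∂F, 1 + dotp y z ∈ utilityDomain p)
    (hpos : ∫⁻ z, (Ifun p h y z).posPart ∂F ≠ ⊤)
    (hneg : ∫⁻ z, ENNReal.ofReal (-(utility p (1 + dotp y z) - dotp y (h z))) ∂F ≠ ⊤) :
    Integrable (fun z => utility p (1 + dotp y z) - dotp y (h z)) F ∧
      eIntegral F (fun z => Ifun p h y z)
        = ((∫ z, (utility p (1 + dotp y z) - dotp y (h z)) ∂F : ℝ) : EReal) := by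
  have hae : (fun z => Ifun p h y z) =ᵐ[F]
      fun z => ((utility p (1 + dotp y z) - dotp y (h z) : ℝ) : EReal) :=
    hmem.mono fun z hz => Ifun_of_mem hz
  have hm : Measurable fun z => utility p (1 + dotp y z) - dotp y (h z) :=
    ((measurable_utility p).comp ((measurable_dotp y).const_add 1)).sub
      ((measurable_dotp y).comp hh)
  have hint := integrable_of_lintegral_ofReal_ne_top hm.aestronglyMeasurable (F := F) (by
    rwa [lintegral_congr_ae (hae.mono fun z hz => by
      simp only at hz
      rw [hz, EReal.posPart_coe])] at hpos) hneg
  exact ⟨hint, (eIntegral_congr_ae hae).trans (eIntegral_coe hint)⟩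

/-- Either the integral of `Ifun` is `-∞`, or its integrand is almost everywhere real and
integrable. -/
lemma eIntegral_Ifun_eq_bot_or {d : ℕ} {p : ℝ}
    {h : EuclideanSpace ℝ (Fin d) → EuclideanSpace ℝ (Fin d)} (hh : Measurable h)
    {F : Measure (EuclideanSpace ℝ (Fin d))} {y : EuclideanSpace ℝ (Fin d)}
    (hy : ∀ᵐ z ∂F, -1 ≤ dotp y z) (hpos : ∫⁻ z, (Ifun p h y z).posPart ∂F ≠ ⊤) :
    eIntegral F (fun z => Ifun p h y z) = ⊥ ∨
      (∀ᵐ z ∂F, 1 + dotp y z ∈ utilityDomain p) ∧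
      Integrable (fun z => utility p (1 + dotp y z) - dotp y (h z)) F ∧
      eIntegral F (fun z => Ifun p h y z)
        = ((∫ z, (utility p (1 + dotp y z) - dotp y (h z)) ∂F : ℝ) : EReal) := by
  by_cases hneg : ∫⁻ z, (-(Ifun p h y z)).posPart ∂F = ⊤
  · exact Or.inl (eIntegral_eq_bot hneg)
  · have hmem : ∀ᵐ z ∂F, 1 + dotp y z ∈ utilityDomain p := by
      filter_upwards [hy, ae_ne_bot_of_lintegral_posPart_neg_ne_top (measurable_Ifun p hh y) hneg]
        with z hz hb using mem_utilityDomain_of_ne_bot hz hb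
    refine Or.inr ⟨hmem, eIntegral_Ifun_eq_integral hh hmem hpos ?_⟩
    rwa [lintegral_congr_ae (hmem.mono fun z hz => by
      rw [Ifun_of_mem hz, ← EReal.coe_neg, EReal.posPart_coe])] at hneg

lemma ae_neg_one_le_dotp_iff {d : ℕ} {F : Measure (EuclideanSpace ℝ (Fin d))}
    {y : EuclideanSpace ℝ (Fin d)} : F {z | dotp y z < -1} = 0 ↔ ∀ᵐ z ∂F, -1 ≤ dotp y z := by
  simp [ae_iff]

lemma ae_neg_one_le_dotp_combo {d : ℕ} {F : Measure (EuclideanSpace ℝ (Fin d))}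
    {x y : EuclideanSpace ℝ (Fin d)} (hx : ∀ᵐ z ∂F, -1 ≤ dotp x z)
    (hy : ∀ᵐ z ∂F, -1 ≤ dotp y z) {s t : ℝ} (hs : 0 ≤ s) (ht : 0 ≤ t) (hst : s + t = 1) :
    ∀ᵐ z ∂F, -1 ≤ dotp (s • x + t • y) z := by
  filter_upwards [hx, hy] with z h1 h2
  rw [dotp_combo]
  nlinarith

/-- Fix `p = 0` or `p ∈ (-∞,0) ∪ (0,1)`, a drift `b`, a symmetric positive
semidefinite matrix `c`, and a Lévy measure `F` with `∫ |z|² ∧ log(1+|z|) F(dz) < ∞` if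
`p = 0` and `∫ |z|² ∧ |z|^{p(1+ε)} F(dz) < ∞` for some `ε > 0` if `p ∈ (0,1)`. Then
`C⁰_F = {y : F({z : y^⊤z < -1}) = 0}` is convex and `g^{(b,c,F)}` is concave on `C⁰_F` in
the extended sense. -/
theorem stmt3 {d : ℕ} (hd : 1 ≤ d) (p : ℝ) (hp : p = 0 ∨ p < 0 ∨ (0 < p ∧ p < 1))
    (h : EuclideanSpace ℝ (Fin d) → EuclideanSpace ℝ (Fin d)) (hh : IsTruncation h)
    (b : EuclideanSpace ℝ (Fin d)) (c : Matrix (Fin d) (Fin d) ℝ) (hc : c.PosSemidef)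
    (F : Measure (EuclideanSpace ℝ (Fin d))) (hF : IsLevyMeasure F)
    (hFint0 : p = 0 → ∫⁻ z, ENNReal.ofReal (min (‖z‖ ^ 2) (Real.log (1 + ‖z‖))) ∂F < ⊤)
    (hFintp : 0 < p → p < 1 →
      ∃ ε : ℝ, 0 < ε ∧ ∫⁻ z, ENNReal.ofReal (min (‖z‖ ^ 2) (‖z‖ ^ (p * (1 + ε)))) ∂F < ⊤) :
    Convex ℝ {y : EuclideanSpace ℝ (Fin d) | F {z | dotp y z < -1} = 0} ∧
    ∀ y₀ ∈ {y : EuclideanSpace ℝ (Fin d) | F {z | dotp y z < -1} = 0},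
    ∀ y₁ ∈ {y : EuclideanSpace ℝ (Fin d) | F {z | dotp y z < -1} = 0},
    ∀ t : ℝ, 0 ≤ t → t ≤ 1 →
      ((t : ℝ) : EReal) * gfun p h b c F y₀ + (((1 - t : ℝ)) : EReal) * gfun p h b c F y₁ ≤
        gfun p h b c F (t • y₀ + (1 - t) • y₁) := by
  simp only [mem_ofPred_eq, ae_neg_one_le_dotp_iff]
  refine ⟨fun x hx y hy s t hs ht hst => ae_neg_one_le_dotp_combo hx hy hs ht hst,
    fun y₀ hy₀ y₁ hy₁ t ht0 ht1 => ?_⟩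
  have hp1 : p < 1 := by rcases hp with h | h | h <;> linarith
  rcases ht0.eq_or_lt with rfl | ht0'
  · simp
  rcases ht1.eq_or_lt with rfl | ht1'
  · simp
  have ht1s : 0 < 1 - t := sub_pos.2 ht1'
  have hyt := ae_neg_one_le_dotp_combo hy₀ hy₁ ht0 ht1s.le (add_sub_cancel t 1)
  have hfin := fun {y} => lintegral_posPart_Ifun_ne_top (y := y) hp hh hF hFint0 hFintp
  rcases eIntegral_Ifun_eq_bot_or hh.measurable hy₀ (hfin hy₀) with h0 | ⟨hm0, hi0, h0⟩
  · simp [gfun, h0, EReal.coe_mul_bot_of_pos ht0']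
  rcases eIntegral_Ifun_eq_bot_or hh.measurable hy₁ (hfin hy₁) with h1 | ⟨hm1, hi1, h1⟩
  · rw [gfun, gfun, h1, EReal.add_bot, EReal.coe_mul_bot_of_pos ht1s, EReal.add_bot]
    exact bot_le
  have hcombo := (hi0.const_mul t).add (hi1.const_mul (1 - t))
  have hdom : ∀ z, t * (1 + dotp y₀ z) + (1 - t) * (1 + dotp y₁ z)
      = 1 + dotp (t • y₀ + (1 - t) • y₁) z := fun z => by
    rw [dotp_combo]
    ring
  have hmt : ∀ᵐ z ∂F, 1 + dotp (t • y₀ + (1 - t) • y₁) z ∈ utilityDomain p := by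
    filter_upwards [hm0, hm1] with z hz0 hz1
    rw [← hdom]
    exact (concaveOn_utility hp1).1 hz0 hz1 ht0 ht1s.le (add_sub_cancel t 1)
  have hle : ∀ᵐ z ∂F, t * (utility p (1 + dotp y₀ z) - dotp y₀ (h z))
      + (1 - t) * (utility p (1 + dotp y₁ z) - dotp y₁ (h z))
      ≤ utility p (1 + dotp (t • y₀ + (1 - t) • y₁) z) - dotp (t • y₀ + (1 - t) • y₁) (h z) := by
    filter_upwards [hm0, hm1] with z hz0 hz1
    have := (concaveOn_utility hp1).2 hz0 hz1 ht0 ht1s.le (add_sub_cancel t 1)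
    simp only [smul_eq_mul, hdom] at this
    rw [dotp_combo t (1 - t) y₀ y₁ (h z)]
    linarith
  obtain ⟨hit, hIt⟩ := eIntegral_Ifun_eq_integral hh.measurable hmt (hfin hyt)
    (ne_top_of_le_ne_top hcombo.neg.lintegral_lt_top.ne (lintegral_mono_ae
      (hle.mono fun z hz => ENNReal.ofReal_le_ofReal (neg_le_neg hz))))
  have hint := integral_mono_ae hcombo hit hle
  simp only [Pi.add_apply] at hint
  rw [integral_add (hi0.const_mul t) (hi1.const_mul (1 - t)), integral_const_mul,
    integral_const_mul] at hint
  have hq := quadf_combo_le hc y₀ y₁ ht0 ht1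
  simp only [gfun, h0, h1, hIt]
  norm_cast
  rw [dotp_combo]
  nlinarith
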